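/- Let C be a weakly separable clustering of X for N_p, and let C' be a partial clustering of X (a collection of pairwise disjoint nonempty subsets of X) together with a bijection f : C' → C such that c' ⊆ f(c') for every c' ∈ C', and suppose the union of the sets in C' is not all of X. Then every pair (x*, c*) with x* ∈ X not belonging to any set of C' and c* ∈ C' that minimizes the ε-distance ε(x*, c*) (over all such pairs) satisfies x* ∈ f(c*); that is, the greedy expansion step of adding the unclustered point of minimum ε-distance to its nearest partial cluster always assigns a point to (the partial cluster of) its true cluster. -/

import Mathlib

variable {α : Type*}

/-- Sparsity ε_{N_p}(x): smallest ε ≥ 0 such that at least N_p points of X lie within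
distance ε of x. -/
noncomputable def sparsity [MetricSpace α] (X : Finset α) (Np : ℕ) (x : α) : ℝ :=
  sInf {ε : ℝ | 0 ≤ ε ∧ Np ≤ (X.filter (fun y => dist x y ≤ ε)).card}

/-- x is ε-connected to y: there is a finite sequence of points of X from x to y,
each of sparsity at most ε, with consecutive distances at most ε. -/
def EpsConn [MetricSpace α] (X : Finset α) (Np : ℕ) (ε : ℝ) (x y : α) : Prop :=
  x ∈ X ∧ sparsity X Np x ≤ ε ∧
    Relation.ReflTransGen (fun a b => b ∈ X ∧ sparsity X Np b ≤ ε ∧ dist a b ≤ ε) x y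

/-- A set c is ε-connected if every pair of points of c is ε-connected. -/
def SetConn [MetricSpace α] (X : Finset α) (Np : ℕ) (ε : ℝ) (c : Finset α) : Prop :=
  ∀ x ∈ c, ∀ y ∈ c, EpsConn X Np ε x y

/-- ε*(c): the minimum ε such that c is ε-connected. -/
noncomputable def setSparsity [MetricSpace α] (X : Finset α) (Np : ℕ) (c : Finset α) : ℝ :=
  sInf {ε : ℝ | SetConn X Np ε c}

/-- ε(x,y): the minimum ε such that x is ε-connected to y. -/
noncomputable def epsDist [MetricSpace α] (X : Finset α) (Np : ℕ) (x y : α) : ℝ :=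
  sInf {ε : ℝ | EpsConn X Np ε x y}

/-- ε(x,c): min over y ∈ c of ε(x,y). -/
noncomputable def ptClusterDist [MetricSpace α] (X : Finset α) (Np : ℕ) (x : α)
    (c : Finset α) : ℝ :=
  sInf {e : ℝ | ∃ y ∈ c, e = epsDist X Np x y}

/-- ε(c,c'): min over x ∈ c, y ∈ c' of ε(x,y). -/
noncomputable def clusterDist [MetricSpace α] (X : Finset α) (Np : ℕ)
    (c c' : Finset α) : ℝ :=
  sInf {e : ℝ | ∃ x ∈ c, ∃ y ∈ c', e = epsDist X Np x y}

/-- A clustering of X: a partition of X into nonempty clusters. -/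
def IsClustering (X : Finset α) (C : Finset (Finset α)) : Prop :=
  (∀ c ∈ C, c.Nonempty) ∧ (∀ c ∈ C, ∀ c' ∈ C, c ≠ c' → Disjoint c c') ∧
    (∀ c ∈ C, c ⊆ X) ∧ (∀ x ∈ X, ∃ c ∈ C, x ∈ c)

/-- C is weakly separable: for each cluster c, ε*(c) < min over c' ≠ c of ε(c,c'). -/
def WeaklySeparable [MetricSpace α] (X : Finset α) (Np : ℕ) (C : Finset (Finset α)) : Prop :=
  ∀ c ∈ C, ∀ c' ∈ C, c' ≠ c → setSparsity X Np c < clusterDist X Np c c'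

/-- c is an ε-cluster: a (nonempty) maximal ε-connected subset of X. -/
def IsEpsCluster [MetricSpace α] (X : Finset α) (Np : ℕ) (ε : ℝ) (c : Finset α) : Prop :=
  c.Nonempty ∧ SetConn X Np ε c ∧ ∀ x ∈ X, (∃ y ∈ c, EpsConn X Np ε x y) → x ∈ c

/-- c is a maximal cluster: an ε-cluster for some ε ≥ 0. -/
def IsMaximalCluster [MetricSpace α] (X : Finset α) (Np : ℕ) (c : Finset α) : Prop :=
  ∃ ε : ℝ, 0 ≤ ε ∧ IsEpsCluster X Np ε c

/-- x is a local maximum: every y ∈ X with d(x,y) ≤ ε_{N_p}(x) has sparsity ≥ that of x. -/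
def IsLocalMaxPt [MetricSpace α] (X : Finset α) (Np : ℕ) (x : α) : Prop :=
  x ∈ X ∧ ∀ y ∈ X, dist x y ≤ sparsity X Np x → sparsity X Np x ≤ sparsity X Np y

/-- X_c*: the points of c of minimum sparsity within c. -/
noncomputable def minSparsityPts [MetricSpace α] (X : Finset α) (Np : ℕ)
    (c : Finset α) : Finset α :=
  c.filter (fun x => ∀ y ∈ c, sparsity X Np x ≤ sparsity X Np y)

/-- Relative separability A(x,y) = ε(x,y) / ε_{N_p}(x). -/
noncomputable def relSep [MetricSpace α] (X : Finset α) (Np : ℕ) (x y : α) : ℝ :=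
  epsDist X Np x y / sparsity X Np x

/-- A(x,c) = min over y ∈ c of A(x,y). -/
noncomputable def relSepCluster [MetricSpace α] (X : Finset α) (Np : ℕ) (x : α)
    (c : Finset α) : ℝ :=
  sInf {a : ℝ | ∃ y ∈ c, a = relSep X Np x y}

/-- A^ℓ(C): the minimum A such that for every local maximum x, every y in the cluster of x
with sparsity at most that of x satisfies A(x,y) ≤ A. -/
noncomputable def Aell [MetricSpace α] (X : Finset α) (Np : ℕ)
    (C : Finset (Finset α)) : ℝ :=
  sInf {A : ℝ | ∀ x ∈ X, IsLocalMaxPt X Np x → ∀ c ∈ C, x ∈ c →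
    ∀ y ∈ c, sparsity X Np y ≤ sparsity X Np x → relSep X Np x y ≤ A}

/-- C is LM-separable: A^ℓ(C) < min over distinct clusters c, c' and z ∈ X_c* of A(z,c'). -/
def LMSeparable [MetricSpace α] (X : Finset α) (Np : ℕ) (C : Finset (Finset α)) : Prop :=
  ∀ c ∈ C, ∀ c' ∈ C, c ≠ c' → ∀ z ∈ minSparsityPts X Np c,
    Aell X Np C < relSepCluster X Np z c'

/-- min over x ∈ c of ε_{N_p}(x). -/
noncomputable def minSpars [MetricSpace α] (X : Finset α) (Np : ℕ) (c : Finset α) : ℝ :=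
  sInf (sparsity X Np '' (c : Set α))

/-- max over x ∈ c of ε_{N_p}(x). -/
noncomputable def maxSpars [MetricSpace α] (X : Finset α) (Np : ℕ) (c : Finset α) : ℝ :=
  sSup (sparsity X Np '' (c : Set α))

/-- C is strongly separable: there is an A such that each cluster c is
(A · min sparsity of c)-connected and A · min sparsity of c < min over c' ≠ c of ε(c,c'). -/
def StronglySeparable [MetricSpace α] (X : Finset α) (Np : ℕ)
    (C : Finset (Finset α)) : Prop :=
  ∃ A : ℝ, ∀ c ∈ C, SetConn X Np (A * minSpars X Np c) c ∧
    ∀ c' ∈ C, c' ≠ c → A * minSpars X Np c < clusterDist X Np c c'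

/-- c*(x,ε): the set of points of X that are ε-connected to x. -/
def epsClusterAt [MetricSpace α] (X : Finset α) (Np : ℕ) (ε : ℝ) (x : α) : Set α :=
  {y | EpsConn X Np ε x y}

theorem sparsity_nonneg [MetricSpace α] (X : Finset α) (Np : ℕ) (x : α) :
    0 ≤ sparsity X Np x :=
  Real.sInf_nonneg fun _ h => h.1

theorem EpsConn.nonneg [MetricSpace α] {X : Finset α} {Np : ℕ} {ε : ℝ} {x y : α}
    (h : EpsConn X Np ε x y) : 0 ≤ ε :=
  (sparsity_nonneg X Np x).trans h.2.1

theorem epsDist_nonneg [MetricSpace α] (X : Finset α) (Np : ℕ) (x y : α) :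
    0 ≤ epsDist X Np x y :=
  Real.sInf_nonneg fun _ h => h.nonneg

/-- Every subset of `X` is `ε`-connected for some sufficiently large `ε`. -/
theorem exists_setConn [MetricSpace α] {X c : Finset α} (Np : ℕ) (hc : c ⊆ X) :
    ∃ ε, SetConn X Np ε c := by
  obtain ⟨s, hs⟩ := (X.finite_toSet.image (sparsity X Np)).bddAbove
  obtain ⟨t, ht⟩ := ((X ×ˢ X).finite_toSet.image fun p => dist p.1 p.2).bddAbove
  have hsparse : ∀ x ∈ X, sparsity X Np x ≤ max s t := fun x hx =>
    (hs (Set.mem_image_of_mem _ hx)).trans (le_max_left s t)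
  have hdist : ∀ x ∈ X, ∀ y ∈ X, dist x y ≤ max s t := fun x hx y hy =>
    (ht ⟨(x, y), by simp [hx, hy], rfl⟩).trans (le_max_right s t)
  exact ⟨max s t, fun x hx y hy => ⟨hc hx, hsparse x (hc hx),
    .single ⟨hc hy, hsparse y (hc hy), hdist x (hc hx) y (hc hy)⟩⟩⟩

theorem epsDist_le_setSparsity [MetricSpace α] {X c : Finset α} (Np : ℕ) (hc : c ⊆ X)
    {x y : α} (hx : x ∈ c) (hy : y ∈ c) : epsDist X Np x y ≤ setSparsity X Np c :=
  csInf_le_csInf ⟨0, fun _ h => EpsConn.nonneg h⟩ (exists_setConn Np hc)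
    fun _ h => h x hx y hy

theorem ptClusterDist_le_epsDist [MetricSpace α] (X : Finset α) (Np : ℕ) (x : α)
    {c : Finset α} {y : α} (hy : y ∈ c) : ptClusterDist X Np x c ≤ epsDist X Np x y :=
  csInf_le ⟨0, by rintro _ ⟨z, -, rfl⟩; exact epsDist_nonneg X Np x z⟩ ⟨y, hy, rfl⟩

theorem clusterDist_le_ptClusterDist [MetricSpace α] (X : Finset α) (Np : ℕ) {x : α}
    {c d d' : Finset α} (hx : x ∈ c) (hd : d.Nonempty) (hdd' : d ⊆ d') :
    clusterDist X Np c d' ≤ ptClusterDist X Np x d := by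
  refine csInf_le_csInf ⟨0, ?_⟩ ?_ ?_
  · rintro _ ⟨y, -, z, -, rfl⟩
    exact epsDist_nonneg X Np y z
  · obtain ⟨y, hy⟩ := hd
    exact ⟨_, y, hy, rfl⟩
  · rintro _ ⟨y, hy, rfl⟩
    exact ⟨x, hx, y, hdd' hy, rfl⟩

/-- greedy expansion step correctness: if C is weakly separable and C' is a
partial clustering extendable to C via f, then any unclustered point / partial cluster pair
minimizing the ε-distance has the point belonging to the true cluster of that partial
cluster. -/
theorem stmt_10 {α : Type*} [MetricSpace α] (X : Finset α) (Np : ℕ)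
    (hNp : 0 < Np) (hNpX : Np ≤ X.card)
    (C : Finset (Finset α)) (hC : IsClustering X C) (hW : WeaklySeparable X Np C)
    (C' : Finset (Finset α)) (hne : ∀ c' ∈ C', Finset.Nonempty c')
    (hdisj : ∀ c ∈ C', ∀ c' ∈ C', c ≠ c' → Disjoint c c')
    (f : Finset α → Finset α)
    (hfmem : ∀ c' ∈ C', f c' ∈ C)
    (hfinj : ∀ c ∈ C', ∀ c' ∈ C', f c = f c' → c = c')
    (hfsurj : ∀ c ∈ C, ∃ c' ∈ C', f c' = c)
    (hfsub : ∀ c' ∈ C', c' ⊆ f c')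
    (xstar : α) (cstar : Finset α)
    (hx : xstar ∈ X) (hxu : ∀ c' ∈ C', xstar ∉ c') (hcs : cstar ∈ C')
    (hmin : ∀ x ∈ X, (∀ c' ∈ C', x ∉ c') → ∀ c ∈ C',
      ptClusterDist X Np xstar cstar ≤ ptClusterDist X Np x c) :
    xstar ∈ f cstar := by
  obtain ⟨-, -, hCX, hcover⟩ := hC
  obtain ⟨c, hc, hxc⟩ := hcover xstar hx
  by_contra hnot
  have hcne : f cstar ≠ c := fun h => hnot (h ▸ hxc)
  obtain ⟨c', hc', rfl⟩ := hfsurj c hc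
  obtain ⟨y, hy⟩ := hne c' hc'
  have hlt := calc
    ptClusterDist X Np xstar cstar ≤ ptClusterDist X Np xstar c' := hmin xstar hx hxu c' hc'
    _ ≤ epsDist X Np xstar y := ptClusterDist_le_epsDist X Np xstar hy
    _ ≤ setSparsity X Np (f c') :=
      epsDist_le_setSparsity Np (hCX _ hc) hxc (hfsub c' hc' hy)
    _ < clusterDist X Np (f c') (f cstar) := hW _ hc _ (hfmem cstar hcs) hcne
    _ ≤ ptClusterDist X Np xstar cstar :=
      clusterDist_le_ptClusterDist X Np hxc (hne cstar hcs) (hfsub cstar hcs)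
  exact lt_irrefl _ hlt
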